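/- arXiv:2011.07300 — 2 statements merged into one kernel-verified Lean document; each statement's English description precedes it below -/
import Mathlib

section
/- Let k be an algebraically closed field of characteristic zero and let d' be a positive integer. Then k((t^{1/d'})) is, up to isomorphism, the unique field extension of k((t)) of degree d'. -/
/-- The field `k((t^{1/d}))`: as an abstract field it is the Laurent series field over `k`
(in the variable `t^{1/d}`), regarded as an extension of `k((t))` via `t ↦ (t^{1/d})^d`. -/
def RootedLaurent (k : Type*) [Field k] (_d : ℕ) : Type _ := LaurentSeries k

noncomputable instance (k : Type*) [Field k] (d : ℕ) : Field (RootedLaurent k d) :=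
  inferInstanceAs (Field (LaurentSeries k))

/-- The additive map `ℤ →+ ℤ`, `n ↦ d·n`, of exponents. -/
def expMulHom (d : ℕ) : ℤ →+ ℤ where
  toFun n := (d : ℤ) * n
  map_zero' := by simp
  map_add' a b := by ring

/-- The structure of `k((t))`-algebra on `k((t^{1/d}))`: the inclusion `k((t)) → k((t^{1/d}))`
sends a Laurent series in `t` to the same series viewed in the variable `t^{1/d}` via
`t = (t^{1/d})^d`, i.e. it is induced by multiplication by `d` on exponents. -/
noncomputable instance (k : Type*) [Field k] (d : ℕ) [NeZero d] :
    Algebra (LaurentSeries k) (RootedLaurent k d) :=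
  RingHom.toAlgebra
    ((HahnSeries.embDomainRingHom (expMulHom d)
        (fun a b hab => by
          have hd : (0 : ℤ) < d := by exact_mod_cast Nat.pos_of_ne_zero (NeZero.ne d)
          exact mul_left_cancel₀ hd.ne' hab)
        (fun a b => by
          have hd : (0 : ℤ) < d := by exact_mod_cast Nat.pos_of_ne_zero (NeZero.ne d)
          exact mul_le_mul_iff_of_pos_left hd) :
      LaurentSeries k →+* LaurentSeries k) :
      LaurentSeries k →+* RootedLaurent k d)

set_option linter.style.haveILetI false
open Polynomial

lemma aux_precomplete {R M : Type*} [CommRing R] (I : Ideal R) [IsAdicComplete I R]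
    [AddCommGroup M] [Module R M] [Module.Finite R M] : IsPrecomplete I M := by
  rw [← AdicCompletion.of_surjective_iff]
  intro z
  obtain ⟨w, rfl⟩ := AdicCompletion.ofTensorProduct_surjective_of_finite I M z
  induction w with
  | zero => exact ⟨0, by simp⟩
  | add x y hx hy =>
    obtain ⟨a, ha⟩ := hx
    obtain ⟨b, hb⟩ := hy
    exact ⟨a + b, by rw [map_add, map_add, ha, hb]⟩
  | tmul r m =>
    obtain ⟨r', rfl⟩ := AdicCompletion.of_surjective I R r
    refine ⟨r' • m, ?_⟩
    rw [AdicCompletion.ofTensorProduct_tmul]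
    rw [map_smul]
    exact algebraMap_smul (AdicCompletion I R) r' (AdicCompletion.of I M m)

lemma aux_local {B : Type*} [CommRing B] [IsDedekindDomain B] (t : B) (ht : t ≠ 0)
    [H : HenselianRing B (Ideal.span {t})] : IsLocalRing B := by
  have htm : ∀ Q : Ideal B, Q.IsMaximal → t ∈ Q := fun Q hQ => by
    have h := H.jac (Ideal.mem_span_singleton_self t)
    rw [Ideal.jacobson, Ideal.mem_sInf] at h
    exact h ⟨bot_le, hQ⟩
  obtain ⟨P, hP⟩ := Ideal.exists_maximal B
  refine IsLocalRing.of_unique_max_ideal ⟨P, hP, fun Q hQ => ?_⟩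
  have hI : Ideal.span {t} ≠ (0 : Ideal B) := by simpa using ht
  have hP0 : P ≠ ⊥ := fun h => ht (by simpa [h] using htm P hP)
  have hirr : Irreducible P := (Ideal.prime_of_isPrime hP0 hP.isPrime).irreducible
  obtain ⟨n, J, hJ, hIJ⟩ := WfDvdMonoid.max_power_factor hI hirr
  rw [Ideal.dvd_iff_le] at hJ
  have hsup : P ⊔ J = ⊤ := hP.out.2 _ (lt_of_le_of_ne le_sup_left
    (fun h => hJ (le_sup_right.trans h.ge)))
  have hn : n ≠ 0 := by
    rintro rfl
    apply hJ
    rw [pow_zero, one_mul] at hIJ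
    rw [← hIJ, Ideal.span_singleton_le_iff_mem]
    exact htm P hP
  have hsup' : P ^ n ⊔ J = ⊤ := Ideal.pow_sup_eq_top hsup
  obtain ⟨x, hx, y, hy, hxy⟩ := Submodule.mem_sup.1 (hsup' ▸ Submodule.mem_top : (1 : B) ∈ P ^ n ⊔ J)
  have hxyI : x * y ∈ Ideal.span {t} := hIJ ▸ Ideal.mul_mem_mul hx hy
  have hJtop : J = ⊤ := by
    obtain ⟨a, ha, hax⟩ := H.is_henselian (X ^ 2 - X) (by monicity!) x
      (by
        have : eval x (X ^ 2 - X) = - (x * y) := by simp; linear_combination x * hxy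
        rw [this]; exact neg_mem hxyI)
      (by
        refine IsUnit.of_mul_eq_one (Ideal.Quotient.mk _ (2 * x - 1)) ?_
        rw [← map_mul, ← map_one (Ideal.Quotient.mk _), Ideal.Quotient.eq]
        have : eval x (derivative (X ^ 2 - X)) * (2 * x - 1) - 1 = -4 * (x * y) := by
          rw [← eq_sub_iff_add_eq'] at hxy
          simp [hxy]; ring
        rw [this]
        exact Ideal.mul_mem_left _ _ hxyI)
    have ha' : a * (a - 1) = 0 := by
      have : a ^ 2 - a = 0 := by simpa using ha
      linear_combination this
    rcases mul_eq_zero.1 ha' with h | h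
    · rw [h, zero_sub, neg_mem_iff, hIJ] at hax
      have h1 : x ∈ J := (Ideal.mul_le_right (I := P ^ n) (J := J)) hax
      rw [Ideal.eq_top_iff_one, ← hxy]
      exact J.add_mem h1 hy
    · rw [sub_eq_zero.1 h, hIJ] at hax
      have h1 : 1 - x ∈ P := Ideal.pow_le_self hn ((Ideal.mul_le_left (I := P ^ n) (J := J)) hax)
      have h2 : x ∈ P := Ideal.pow_le_self hn hx
      have h3 : (1 : B) ∈ P := by simpa using P.add_mem h1 h2
      exact absurd ((Ideal.eq_top_iff_one P).2 h3) hP.ne_top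
  rw [hJtop, Ideal.mul_top] at hIJ
  have : P ^ n ≤ Q := by
    rw [← hIJ, Ideal.span_singleton_le_iff_mem]
    exact htm Q hQ
  exact (hP.eq_of_le hQ.ne_top (hQ.isPrime.le_of_pow_le this)).symm

lemma aux_root {k B : Type*} [Field k] [IsAlgClosed k] [CharZero k] [CommRing B]
    [IsDedekindDomain B] [IsLocalRing B] [Algebra k B] (t : B) (ht : t ≠ 0)
    [H : HenselianRing B (Ideal.span {t})]
    (hres : ∀ b : B, ∃ c : k, b - algebraMap k B c ∈ IsLocalRing.maximalIdeal B) :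
    ∃ (s : B) (e : ℕ), e ≠ 0 ∧ s ^ e = t ∧ IsLocalRing.maximalIdeal B = Ideal.span {s} := by
  have htm : t ∈ IsLocalRing.maximalIdeal B := by
    have h := H.jac (Ideal.mem_span_singleton_self t)
    rw [Ideal.jacobson, Ideal.mem_sInf] at h
    exact h ⟨bot_le, inferInstance⟩
  have hm0 : IsLocalRing.maximalIdeal B ≠ ⊥ := fun h => ht (by simpa [h] using htm)
  obtain ⟨p, hp⟩ : ∃ p, IsLocalRing.maximalIdeal B = Ideal.span {p} :=
    (IsPrincipalIdealRing.principal (IsLocalRing.maximalIdeal B)).principal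
  have hp0 : p ≠ 0 := by rintro rfl; simp at hp; exact hm0 hp
  have hirr : Irreducible p :=
    ((Ideal.span_singleton_prime hp0).1 (hp ▸ inferInstance)).irreducible
  obtain ⟨e, u, hu, hut⟩ := WfDvdMonoid.max_power_factor ht hirr
  have hunit : IsUnit u := by
    by_contra h
    have : u ∈ IsLocalRing.maximalIdeal B := h
    rw [hp, Ideal.mem_span_singleton] at this
    exact hu this
  have he : e ≠ 0 := by
    rintro rfl
    rw [pow_zero, one_mul] at hut
    exact htm (hut ▸ hunit)
  obtain ⟨c, hc⟩ := hres u
  have hc0 : c ≠ 0 := by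
    rintro rfl
    rw [map_zero, sub_zero] at hc
    exact hc hunit
  obtain ⟨r, hr⟩ := IsAlgClosed.exists_pow_nat_eq c (Nat.pos_of_ne_zero he)
  have hr0 : r ≠ 0 := by rintro rfl; exact hc0 (by rw [← hr, zero_pow he])
  have heunit : IsUnit (e : B) := by
    have : IsUnit (e : k) := by simpa using he
    simpa using this.map (algebraMap k B)
  have hrunit : IsUnit (algebraMap k B r) := (IsUnit.mk0 r hr0).map _
  set q := Ideal.Quotient.mk (Ideal.span {t}) with hq
  obtain ⟨w, ⟨-, hw⟩, -⟩ := existsUnique_nilpotent_sub_and_aeval_eq_zero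
    (P := (X ^ e - C u : B[X])) (x := q (algebraMap k B r))
    (by
      have h1 : algebraMap k B r ^ e - u ∈ IsLocalRing.maximalIdeal B := by
        rw [← map_pow, hr, ← neg_sub]; exact neg_mem hc
      rw [hp, Ideal.mem_span_singleton] at h1
      obtain ⟨z, hz⟩ := h1
      refine ⟨e, ?_⟩
      have : aeval (q (algebraMap k B r)) (X ^ e - C u : B[X]) = q (p * z) := by
        rw [← hz]; simp [hq]
      rw [this, ← map_pow, hq, Ideal.Quotient.eq_zero_iff_mem, Ideal.mem_span_singleton, mul_pow]
      rw [hut]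
      exact (mul_dvd_mul_left _ (hunit.dvd)))
    (by
      have : aeval (q (algebraMap k B r)) (derivative (X ^ e - C u : B[X]))
        = q (e * algebraMap k B r ^ (e - 1)) := by simp [derivative_X_pow]
      rw [this]
      exact (heunit.mul (hrunit.pow _)).map _)
  obtain ⟨w, rfl⟩ := Ideal.Quotient.mk_surjective w
  have hw' : q (w ^ e) = q u := by
    simpa [sub_eq_zero, hq] using hw
  obtain ⟨v, hv, -⟩ := H.is_henselian (X ^ e - C u) (monic_X_pow_sub_C _ he) w
    (by rw [← Ideal.Quotient.eq_zero_iff_mem]; simpa [sub_eq_zero] using hw')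
    (by
      have : eval w (derivative (X ^ e - C u : B[X])) = e * w ^ (e - 1) := by simp [derivative_X_pow]
      rw [this, map_mul]
      refine (heunit.map _).mul ?_
      rw [map_pow]
      refine IsUnit.pow _ ?_
      have : IsUnit (q w ^ e) := by rw [← map_pow, hw']; exact hunit.map _
      exact (isUnit_pow_iff he).1 this)
  have hv' : v ^ e = u := by simpa [sub_eq_zero] using hv
  have hvu : IsUnit v := (isUnit_pow_iff he).1 (hv' ▸ hunit)
  refine ⟨p * v, e, he, by rw [mul_pow, hv', hut], ?_⟩
  rw [hp, Ideal.span_singleton_eq_span_singleton]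
  exact associated_mul_unit_right p v hvu

lemma aux_gen {k A B : Type*} [Field k] [CommRing A] [IsLocalRing A] [Algebra k A] [CommRing B]
    [IsLocalRing B] [Algebra k B] [Algebra A B] [IsScalarTower k A B] [Module.Finite A B]
    (a : A) (ha : a ∈ IsLocalRing.maximalIdeal A) (s : B) (e : ℕ)
    (hs : s ^ e = algebraMap A B a)
    (hm : IsLocalRing.maximalIdeal B = Ideal.span {s})
    (hres : ∀ b : B, ∃ c : k, b - algebraMap k B c ∈ IsLocalRing.maximalIdeal B) :
    Algebra.adjoin A {s} = ⊤ := by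
  have key : ∀ n : ℕ, ∀ b : B, ∃ y ∈ Algebra.adjoin A {s}, ∃ z, b = y + s ^ n * z := by
    intro n
    induction n with
    | zero => exact fun b => ⟨0, zero_mem _, b, by simp⟩
    | succ n ih =>
      intro b
      obtain ⟨y, hy, z, rfl⟩ := ih b
      obtain ⟨c, hc⟩ := hres z
      rw [hm, Ideal.mem_span_singleton] at hc
      obtain ⟨z', hz'⟩ := hc
      refine ⟨y + s ^ n * algebraMap k B c, Subalgebra.add_mem _ hy (Subalgebra.mul_mem _
        (Subalgebra.pow_mem _ (Algebra.self_mem_adjoin_singleton A s) _) ?_), z', ?_⟩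
      · rw [IsScalarTower.algebraMap_apply k A B]
        exact Subalgebra.algebraMap_mem _ _
      · linear_combination s ^ n * hz'
  rw [← Algebra.toSubmodule_eq_top, ← top_le_iff]
  refine Submodule.le_of_le_smul_of_le_jacobson_bot (I := IsLocalRing.maximalIdeal A)
    Module.Finite.fg_top (IsLocalRing.maximalIdeal_le_jacobson _) ?_
  rintro b -
  obtain ⟨y, hy, z, rfl⟩ := key e b
  refine Submodule.add_mem _ (Submodule.mem_sup_left hy) (Submodule.mem_sup_right ?_)
  rw [hs, ← Algebra.smul_def]
  exact Submodule.smul_mem_smul ha trivial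

open PowerSeries in
lemma aux_res {k B : Type*} [Field k] [IsAlgClosed k] [CommRing B] [IsLocalRing B]
    [Algebra k B] [Algebra (PowerSeries k) B] [IsScalarTower k (PowerSeries k) B]
    [Algebra.IsIntegral (PowerSeries k) B]
    (hX : algebraMap (PowerSeries k) B PowerSeries.X ∈ IsLocalRing.maximalIdeal B) (b : B) :
    ∃ c : k, b - algebraMap k B c ∈ IsLocalRing.maximalIdeal B := by
  set q := IsLocalRing.residue B with hq
  have hcomp : q.comp (algebraMap (PowerSeries k) B) =
      (algebraMap k (IsLocalRing.ResidueField B)).comp (PowerSeries.constantCoeff (R := k)) := by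
    ext a
    have h1 : a - algebraMap k (PowerSeries k) (PowerSeries.constantCoeff a) ∈
        Ideal.span {(PowerSeries.X : PowerSeries k)} := by
      rw [Ideal.mem_span_singleton, PowerSeries.X_dvd_iff]
      simp
    rw [Ideal.mem_span_singleton] at h1
    obtain ⟨z, hz⟩ := h1
    have h2 := congrArg (fun x => q (algebraMap (PowerSeries k) B x)) hz
    have h3 : q (algebraMap (PowerSeries k) B PowerSeries.X) = 0 :=
      (IsLocalRing.residue_eq_zero_iff _).2 hX
    simp only [map_sub, map_mul, h3, zero_mul, sub_eq_zero] at h2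
    simp only [RingHom.comp_apply]
    rw [h2, ← IsScalarTower.algebraMap_apply k (PowerSeries k) B]
    rfl
  have hint : Algebra.IsIntegral k (IsLocalRing.ResidueField B) := by
    refine ⟨fun y => ?_⟩
    obtain ⟨y, rfl⟩ := IsLocalRing.residue_surjective y
    obtain ⟨p, hp, hpy⟩ := Algebra.IsIntegral.isIntegral (R := PowerSeries k) y
    refine ⟨p.map (PowerSeries.constantCoeff (R := k)), hp.map _, ?_⟩
    rw [Polynomial.eval₂_map, ← hcomp, ← Polynomial.hom_eval₂, hpy, map_zero]
  obtain ⟨c, hc⟩ := (IsAlgClosed.algebraMap_bijective_of_isIntegral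
    (k := k) (K := IsLocalRing.ResidueField B)).2 (q b)
  refine ⟨c, ?_⟩
  rw [← IsLocalRing.residue_eq_zero_iff, map_sub, sub_eq_zero, ← hq, ← hc]
  rfl

lemma aux_main {k B : Type*} [Field k] [IsAlgClosed k] [CharZero k] [CommRing B]
    [IsDedekindDomain B] [Algebra (PowerSeries k) B] [Module.Finite (PowerSeries k) B]
    [FaithfulSMul (PowerSeries k) B] :
    ∃ (s : B) (e : ℕ), e ≠ 0 ∧ s ^ e = algebraMap (PowerSeries k) B PowerSeries.X ∧
      Algebra.adjoin (PowerSeries k) {s} = ⊤ := by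
  letI : Algebra k B := Algebra.compHom B (algebraMap k (PowerSeries k))
  haveI : IsScalarTower k (PowerSeries k) B := IsScalarTower.of_algebraMap_eq fun _ => rfl
  set A := PowerSeries k
  set t := algebraMap A B PowerSeries.X with ht
  have hXm : (PowerSeries.X : A) ∈ IsLocalRing.maximalIdeal A := by
    rw [PowerSeries.maximalIdeal_eq_span_X]; exact Ideal.mem_span_singleton_self _
  have ht0 : t ≠ 0 := by
    rw [ht, Ne, FaithfulSMul.algebraMap_eq_zero_iff]; exact PowerSeries.X_ne_zero
  haveI : Module.IsTorsionFree A B := inferInstance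
  haveI h1 : IsAdicComplete (Ideal.span {(PowerSeries.X : A)}) B :=
    { toIsHausdorff := IsHausdorff.of_isLocalRing _ _ (by
        rw [← PowerSeries.maximalIdeal_eq_span_X]
        exact Ideal.IsPrime.ne_top inferInstance)
      toIsPrecomplete := aux_precomplete _ }
  rw [← IsAdicComplete.map_algebraMap_iff (S := B), Ideal.map_span, Set.image_singleton] at h1
  haveI h2 : HenselianRing B (Ideal.span {t}) := inferInstance
  haveI : IsLocalRing B := aux_local t ht0
  have htm : t ∈ IsLocalRing.maximalIdeal B := by
    have h := h2.jac (Ideal.mem_span_singleton_self t)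
    rw [Ideal.jacobson, Ideal.mem_sInf] at h
    exact h ⟨bot_le, inferInstance⟩
  have hres := aux_res (k := k) (B := B) htm
  obtain ⟨s, e, he, hs, hm⟩ := aux_root t ht0 hres
  exact ⟨s, e, he, hs, aux_gen PowerSeries.X hXm s e hs hm hres⟩

lemma aux_ext (k : Type*) [Field k] [IsAlgClosed k] [CharZero k] (L : Type*) [Field L]
    [Algebra (LaurentSeries k) L] [FiniteDimensional (LaurentSeries k) L] :
    ∃ (s : L) (e : ℕ), e ≠ 0 ∧ s ^ e = algebraMap (LaurentSeries k) L (HahnSeries.single 1 1) ∧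
      Algebra.adjoin (LaurentSeries k) {s} = ⊤ := by
  letI : Algebra (PowerSeries k) L :=
    Algebra.compHom L (algebraMap (PowerSeries k) (LaurentSeries k))
  haveI : IsScalarTower (PowerSeries k) (LaurentSeries k) L :=
    IsScalarTower.of_algebraMap_eq fun _ => rfl
  haveI : CharZero (LaurentSeries k) := charZero_of_injective_ringHom
    (HahnSeries.C_injective (Γ := ℤ) (R := k))
  haveI : FaithfulSMul (PowerSeries k) L := by
    rw [faithfulSMul_iff_algebraMap_injective,
      IsScalarTower.algebraMap_eq (PowerSeries k) (LaurentSeries k) L]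
    exact (algebraMap (LaurentSeries k) L).injective.comp
      (IsFractionRing.injective (PowerSeries k) (LaurentSeries k))
  let B := integralClosure (PowerSeries k) L
  haveI : IsDedekindDomain B := integralClosure.isDedekindDomain (PowerSeries k) (LaurentSeries k) L
  haveI : Module.Finite (PowerSeries k) B :=
    IsIntegralClosure.finite (PowerSeries k) (LaurentSeries k) L B
  obtain ⟨s, e, he, hs, hadj⟩ := aux_main (k := k) (B := B)
  have hmem : ∀ b : B, (b : L) ∈ Algebra.adjoin (LaurentSeries k) {(s : L)} := by
    intro b
    have hb : b ∈ Algebra.adjoin (PowerSeries k) {s} := hadj ▸ Algebra.mem_top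
    induction hb using Algebra.adjoin_induction with
    | mem x hx =>
      rw [Set.mem_singleton_iff.1 hx]
      exact Algebra.self_mem_adjoin_singleton _ _
    | algebraMap r =>
      change algebraMap (PowerSeries k) L r ∈ _
      rw [IsScalarTower.algebraMap_apply (PowerSeries k) (LaurentSeries k) L]
      exact Subalgebra.algebraMap_mem _ _
    | add x y _ _ hx hy => exact Subalgebra.add_mem _ hx hy
    | mul x y _ _ hx hy => exact Subalgebra.mul_mem _ hx hy
  refine ⟨s, e, he, ?_, ?_⟩
  · have := congrArg (fun b : B => (b : L)) hs
    simp only [SubmonoidClass.coe_pow] at this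
    rw [this]
    change algebraMap (PowerSeries k) L _ = _
    rw [IsScalarTower.algebraMap_apply (PowerSeries k) (LaurentSeries k) L]
    congr 1
    exact HahnSeries.ofPowerSeries_X
  · rw [eq_top_iff]
    rintro x -
    haveI := IsIntegralClosure.isLocalization (PowerSeries k) (LaurentSeries k) L B
    obtain ⟨b, ⟨_, a, ha, rfl⟩, rfl⟩ := IsLocalization.exists_mk'_eq
      (Algebra.algebraMapSubmonoid B (nonZeroDivisors (PowerSeries k))) x
    have ha0 : a ≠ 0 := nonZeroDivisors.ne_zero ha
    have haL : algebraMap (PowerSeries k) L a ≠ 0 := by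
      rwa [Ne, FaithfulSMul.algebraMap_eq_zero_iff]
    have : IsLocalization.mk' L b (⟨algebraMap (PowerSeries k) B a, ⟨a, ha, rfl⟩⟩ :
        Algebra.algebraMapSubmonoid B (nonZeroDivisors (PowerSeries k))) =
        algebraMap (LaurentSeries k) L ((algebraMap (PowerSeries k) (LaurentSeries k) a)⁻¹) * b := by
      rw [IsLocalization.mk'_eq_iff_eq_mul, map_inv₀,
        ← IsScalarTower.algebraMap_apply (PowerSeries k) (LaurentSeries k) L]
      change (b : L) = _ * algebraMap (PowerSeries k) L a
      field_simp
    rw [this]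
    exact Subalgebra.mul_mem _ (Subalgebra.algebraMap_mem _ _) (hmem b)

lemma aux_irred (k : Type*) [Field k] (e : ℕ) (he : e ≠ 0) :
    Irreducible (X ^ e - C (HahnSeries.single 1 1) : (LaurentSeries k)[X]) := by
  have hm : (X ^ e - C PowerSeries.X : (PowerSeries k)[X]).Monic := monic_X_pow_sub_C _ he
  have h := (hm.irreducible_iff_irreducible_map_fraction_map (K := LaurentSeries k)).1 (by
    refine IsEisensteinAt.irreducible (𝓟 := Ideal.span {PowerSeries.X}) ?_
      PowerSeries.span_X_isPrime hm.isPrimitive (by rw [natDegree_X_pow_sub_C]; omega)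
    refine ⟨?_, ?_, ?_⟩
    · rw [hm.leadingCoeff]
      intro h
      exact PowerSeries.span_X_isPrime.ne_top ((Ideal.eq_top_iff_one _).2 h)
    · intro n hn
      rw [natDegree_X_pow_sub_C] at hn
      rw [coeff_sub, coeff_X_pow, if_neg hn.ne, zero_sub, coeff_C]
      split_ifs
      · exact neg_mem (Ideal.mem_span_singleton_self _)
      · simp
    · rw [coeff_sub, coeff_X_pow, if_neg he.symm, zero_sub, coeff_C_zero, neg_mem_iff,
        Ideal.span_singleton_pow, Ideal.mem_span_singleton]
      intro h
      rw [PowerSeries.X_pow_dvd_iff] at h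
      simpa using h 1 (by norm_num))
  have h3 : algebraMap (PowerSeries k) (LaurentSeries k) PowerSeries.X = HahnSeries.single 1 1 :=
    HahnSeries.ofPowerSeries_X
  simpa [h3] using h

lemma aux_pb (k : Type*) [Field k] (L : Type*) [Field L] [Algebra (LaurentSeries k) L]
    (s : L) (e : ℕ) (he : e ≠ 0)
    (hs : s ^ e = algebraMap (LaurentSeries k) L (HahnSeries.single 1 1))
    (hadj : Algebra.adjoin (LaurentSeries k) {s} = ⊤) :
    ∃ pb : PowerBasis (LaurentSeries k) L,
      minpoly (LaurentSeries k) pb.gen = X ^ e - C (HahnSeries.single 1 1) ∧ pb.dim = e := by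
  have hm : (X ^ e - C (HahnSeries.single 1 1) : (LaurentSeries k)[X]).Monic :=
    monic_X_pow_sub_C _ he
  have hz : aeval s (X ^ e - C (HahnSeries.single 1 1) : (LaurentSeries k)[X]) = 0 := by
    simp [hs]
  have hmin := minpoly.eq_of_irreducible_of_monic (aux_irred k e he) hz hm
  have hint : IsIntegral (LaurentSeries k) s := ⟨_, hm, hz⟩
  refine ⟨PowerBasis.ofAdjoinEqTop hint hadj, ?_, ?_⟩
  · rw [PowerBasis.ofAdjoinEqTop_gen, ← hmin]
  · rw [PowerBasis.ofAdjoinEqTop_dim, ← hmin, natDegree_X_pow_sub_C]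

/-- The variable `t^{1/d}`. -/
noncomputable def rootVar (k : Type*) [Field k] (d : ℕ) : RootedLaurent k d :=
  (HahnSeries.single 1 1 : LaurentSeries k)

lemma aux_algebraMap_coeff (k : Type*) [Field k] (d : ℕ) [NeZero d] (f : LaurentSeries k) (n : ℤ) :
    (show LaurentSeries k from algebraMap (LaurentSeries k) (RootedLaurent k d) f).coeff (d * n)
      = f.coeff n :=
  HahnSeries.embDomain_mk_coeff (f := expMulHom d) _ _

lemma aux_algebraMap_coeff_of_not_dvd (k : Type*) [Field k] (d : ℕ) [NeZero d]
    (f : LaurentSeries k) (m : ℤ) (hm : ¬ (d : ℤ) ∣ m) :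
    (show LaurentSeries k from algebraMap (LaurentSeries k) (RootedLaurent k d) f).coeff m = 0 := by
  refine HahnSeries.embDomain_of_notMem_range ?_
  rintro ⟨a, rfl⟩
  exact hm ⟨a, rfl⟩

lemma aux_rooted_pow (k : Type*) [Field k] (d : ℕ) [NeZero d] :
    rootVar k d ^ d = algebraMap (LaurentSeries k) (RootedLaurent k d) (HahnSeries.single 1 1) := by
  have h1 : rootVar k d ^ d = (HahnSeries.single (d : ℤ) 1 : LaurentSeries k) := by
    change (HahnSeries.single 1 1 : LaurentSeries k) ^ d = _
    rw [HahnSeries.single_pow]; simp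
  rw [h1]
  symm
  refine HahnSeries.embDomain_single.trans ?_
  change HahnSeries.single ((d : ℤ) * 1) 1 = _
  rw [mul_one]

lemma aux_exists_part (k : Type*) [Field k] (d : ℕ) [NeZero d] (f : LaurentSeries k) (j : ℕ) :
    ∃ g : LaurentSeries k, ∀ n : ℤ, g.coeff n = f.coeff (d * n + j) := by
  refine ⟨HahnSeries.ofSuppBddBelow (fun n => f.coeff (d * n + j)) ⟨min (f.order - j) 0, ?_⟩,
    fun n => rfl⟩
  intro n hn
  have hd : (1 : ℤ) ≤ d := by exact_mod_cast Nat.pos_of_ne_zero (NeZero.ne d)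
  have h : f.order ≤ d * n + j := by
    by_contra h
    exact hn (HahnSeries.coeff_eq_zero_of_lt_order (not_le.1 h))
  by_cases hn0 : 0 ≤ n
  · exact (min_le_right _ _).trans hn0
  · refine (min_le_left _ _).trans ?_
    nlinarith

lemma aux_rooted_adjoin (k : Type*) [Field k] (d : ℕ) [NeZero d] :
    Algebra.adjoin (LaurentSeries k) {rootVar k d} = ⊤ := by
  rw [eq_top_iff]
  rintro f -
  choose g hg using aux_exists_part k d (show LaurentSeries k from f)
  have hd : (0 : ℤ) < d := by exact_mod_cast Nat.pos_of_ne_zero (NeZero.ne d)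
  have hf : f = ∑ j ∈ Finset.range d,
      algebraMap (LaurentSeries k) (RootedLaurent k d) (g j) * rootVar k d ^ j := by
    have hpow : ∀ j : ℕ, rootVar k d ^ j = (HahnSeries.single (j : ℤ) 1 : LaurentSeries k) := by
      intro j
      change (HahnSeries.single 1 1 : LaurentSeries k) ^ j = _
      rw [HahnSeries.single_pow]; simp
    change (show LaurentSeries k from f) = ∑ j ∈ Finset.range d,
      (show LaurentSeries k from algebraMap (LaurentSeries k) (RootedLaurent k d) (g j)) *
        (show LaurentSeries k from rootVar k d ^ j)
    ext m
    rw [HahnSeries.coeff_sum]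
    have hterm : ∀ j ∈ Finset.range d,
        ((show LaurentSeries k from algebraMap (LaurentSeries k) (RootedLaurent k d) (g j)) *
        (show LaurentSeries k from rootVar k d ^ j)).coeff m =
        if j = (m % d).toNat then (show LaurentSeries k from f).coeff m else 0 := by
      intro j hj
      have hj' : (j : ℤ) < d := by exact_mod_cast Finset.mem_range.1 hj
      have e1 : (show LaurentSeries k from rootVar k d ^ j) = HahnSeries.single (j : ℤ) 1 := hpow j
      rw [e1, HahnSeries.coeff_mul_single, mul_one]
      have hmod := Int.emod_nonneg m hd.ne'
      have hmod' := Int.emod_lt_of_pos m hd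
      have hdm := Int.mul_ediv_add_emod m d
      split_ifs with h
      · have hjm : (j : ℤ) = m % d := by omega
        have : m - j = d * (m / d) := by omega
        rw [this, aux_algebraMap_coeff, hg]
        congr 1
        omega
      · refine aux_algebraMap_coeff_of_not_dvd k d _ _ fun hdvd => h ?_
        have h1 : m % d = (j : ℤ) % d :=
          Int.emod_eq_emod_iff_emod_sub_eq_zero.2 (Int.emod_eq_zero_of_dvd hdvd)
        rw [Int.emod_eq_of_lt (by positivity) hj'] at h1
        omega
    rw [Finset.sum_congr rfl hterm, Finset.sum_ite_eq', if_pos]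
    rw [Finset.mem_range]
    have hmod' := Int.emod_lt_of_pos m hd
    have hmod := Int.emod_nonneg m hd.ne'
    omega
  rw [hf]
  exact Subalgebra.sum_mem _ fun j _ => Subalgebra.mul_mem _ (Subalgebra.algebraMap_mem _ _)
    (Subalgebra.pow_mem _ (Algebra.self_mem_adjoin_singleton _ _) _)

/-- `k((t^{1/d'}))` is, up to isomorphism, the unique field extension of `k((t))` of degree
`d'`: it has degree `d'`, and any field extension of `k((t))` of degree `d'` is isomorphic to it
over `k((t))`. -/
theorem laurentSeries_unique_extension_of_degree (k : Type*) [Field k] [IsAlgClosed k]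
    [CharZero k] (d' : ℕ) [NeZero d'] :
    Module.finrank (LaurentSeries k) (RootedLaurent k d') = d' ∧
      ∀ (L : Type*) (_ : Field L) (_ : Algebra (LaurentSeries k) L),
        Module.finrank (LaurentSeries k) L = d' →
        Nonempty (L ≃ₐ[LaurentSeries k] RootedLaurent k d') := by
  obtain ⟨pb, hpb, hdim⟩ := aux_pb k (RootedLaurent k d') (rootVar k d') d' (NeZero.ne d')
    (aux_rooted_pow k d') (aux_rooted_adjoin k d')
  refine ⟨by rw [pb.finrank, hdim], ?_⟩
  intro L _ _ hL
  haveI : FiniteDimensional (LaurentSeries k) L :=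
    FiniteDimensional.of_finrank_pos (by rw [hL]; exact Nat.pos_of_ne_zero (NeZero.ne d'))
  obtain ⟨s, e, he, hs, hadj⟩ := aux_ext k L
  obtain ⟨pb', hpb', hdim'⟩ := aux_pb k L s e he hs hadj
  have hed : e = d' := by rw [← hdim', ← pb'.finrank, hL]
  subst hed
  exact ⟨pb'.equivOfMinpoly pb (by rw [hpb', hpb])⟩
end

section
/- Let k be an algebraically closed field of characteristic zero and let n be a positive integer. Consider the k-algebra endomorphism f of R = k[x,y,z]/(xy + z²) given by f(x) = x², f(y) = xy, f(z) = xz, and the k-algebra homomorphism γ : R → k[[t]] with γ(x) = t, γ(y) = γ(z) = 0. Then the pullback γ^*Ω_{R/k} of the Kähler differentials satisfies: γ^*Ω_{R/k} ≅ k[[t]]·dx ⊕ (k[[t]]/(t))·dy ⊕ k[[t]]·dz, and the cokernel of the map induced by f (sending dx ↦ 2x dx, dy ↦ y dx + x dy, dz ↦ z dx + x dz, then pulling back along γ) has length 3, while the cokernel of the induced map into γ^*Ω_{R/k} modulo its torsion has length 2. -/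
open MvPolynomial TensorProduct

noncomputable section

/-- The relation `xy + z²`. -/
def rel (k : Type*) [Field k] : MvPolynomial (Fin 3) k :=
  X 0 * X 1 + X 2 ^ 2

/-- The ring `R = k[x,y,z]/(xy + z²)`. -/
abbrev RQ (k : Type*) [Field k] :=
  MvPolynomial (Fin 3) k ⧸ Ideal.span {rel k}

/-- The substitution `x ↦ x², y ↦ xy, z ↦ xz` on `k[x,y,z]`. -/
def g0 (k : Type*) [Field k] : MvPolynomial (Fin 3) k →ₐ[k] MvPolynomial (Fin 3) k :=
  aeval ![X 0 ^ 2, X 0 * X 1, X 0 * X 2]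

lemma g0_rel (k : Type*) [Field k] : g0 k (rel k) = X 0 ^ 2 * rel k := by
  simp only [g0, rel, map_add, map_mul, map_pow, aeval_X, Matrix.cons_val_zero,
    Matrix.cons_val_one, Matrix.head_cons, Matrix.cons_val_two, Matrix.tail_cons]
  ring

/-- The `k`-algebra endomorphism `f` of `R` with `f(x) = x²`, `f(y) = xy`, `f(z) = xz`. -/
def fEnd (k : Type*) [Field k] : RQ k →ₐ[k] RQ k :=
  Ideal.Quotient.liftₐ (Ideal.span {rel k})
    ((Ideal.Quotient.mkₐ k (Ideal.span {rel k})).comp (g0 k))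
    (by
      intro a ha
      rw [Ideal.mem_span_singleton] at ha
      obtain ⟨c, rfl⟩ := ha
      have h0 : (Ideal.Quotient.mkₐ k (Ideal.span {rel k})) (rel k) = 0 :=
        Ideal.Quotient.eq_zero_iff_mem.mpr (Ideal.subset_span rfl)
      simp only [AlgHom.comp_apply, map_mul, g0_rel, h0, mul_zero, zero_mul])

/-- The `k`-algebra homomorphism `γ : R → k[[t]]` with `γ(x) = t`, `γ(y) = γ(z) = 0`. -/
def gam (k : Type*) [Field k] : RQ k →ₐ[k] PowerSeries k :=
  Ideal.Quotient.liftₐ (Ideal.span {rel k})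
    (aeval ![(PowerSeries.X : PowerSeries k), 0, 0])
    (by
      intro a ha
      rw [Ideal.mem_span_singleton] at ha
      obtain ⟨c, rfl⟩ := ha
      have h0 : aeval ![(PowerSeries.X : PowerSeries k), 0, 0] (rel k) = 0 := by
        simp [rel]
      rw [map_mul, h0, zero_mul])

/-- The length of a module: the Krull dimension of its submodule lattice. -/
def modLength (R : Type*) [Ring R] (M : Type*) [AddCommGroup M] [Module R M] :
    WithBot ℕ∞ :=
  Order.krullDim (Submodule R M)

lemma one_tmul_smul {A S M : Type*} [CommRing A] [CommRing S] [Algebra A S] [AddCommGroup M]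
    [Module A M] (r : A) (m : M) :
    (1 : S) ⊗ₜ[A] (r • m) = (algebraMap A S r) • ((1 : S) ⊗ₜ[A] m) := by
  rw [smul_tmul', smul_eq_mul, mul_one, Algebra.algebraMap_eq_smul_one, smul_tmul]

lemma exists_der (k : Type*) [Field k] (N : Type*) [AddCommGroup N] [Module k N]
    [Module (RQ k) N] [IsScalarTower k (RQ k) N] (n : Fin 3 → N)
    (hn : (Ideal.Quotient.mk (Ideal.span {rel k}) (X 1)) • n 0 +
      (Ideal.Quotient.mk (Ideal.span {rel k}) (X 0)) • n 1 +
      (2 : ℕ) • (Ideal.Quotient.mk (Ideal.span {rel k}) (X 2)) • n 2 = 0) :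
    ∃ D : Derivation k (RQ k) N, ∀ i, D (Ideal.Quotient.mk (Ideal.span {rel k}) (X i)) = n i := by
  let _ : Module (MvPolynomial (Fin 3) k) N :=
    Module.compHom N (Ideal.Quotient.mk (Ideal.span {rel k}))
  have hsm : ∀ (p : MvPolynomial (Fin 3) k) (m : N),
      p • m = (Ideal.Quotient.mk (Ideal.span {rel k}) p) • m := fun _ _ => rfl
  have : IsScalarTower k (MvPolynomial (Fin 3) k) N := ⟨fun c p m => by
    rw [hsm, hsm, ← smul_assoc]; rfl⟩
  let d := mkDerivation k n
  have hd : ∀ p q : MvPolynomial (Fin 3) k, Ideal.Quotient.mk (Ideal.span {rel k}) p =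
      Ideal.Quotient.mk (Ideal.span {rel k}) q → d p = d q := by
    intro p q h
    rw [Ideal.Quotient.eq, Ideal.mem_span_singleton] at h
    obtain ⟨c, hc⟩ := h
    have h0 : d (rel k) = 0 := by
      rw [← hn]
      change mkDerivation k n (X 0 * X 1 + X 2 ^ 2) = _
      rw [map_add, Derivation.leibniz, Derivation.leibniz_pow, mkDerivation_X,
        mkDerivation_X, mkDerivation_X, hsm, hsm, hsm, Nat.add_one_sub_one, pow_one]
      exact congrArg (· + _) (add_comm _ _)
    have h1 : (rel k) • d c = 0 := by
      have hz : Ideal.Quotient.mk (Ideal.span {rel k}) (rel k) = 0 :=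
        Ideal.Quotient.eq_zero_iff_mem.mpr (Ideal.subset_span rfl)
      rw [hsm, hz]
      exact zero_smul (RQ k) (d c)
    have : d (p - q) = 0 := by
      rw [hc, Derivation.leibniz, h0, h1, smul_zero, add_zero]
    rwa [map_sub, sub_eq_zero] at this
  let F : RQ k → N := fun r => d (Function.surjInv Ideal.Quotient.mk_surjective r)
  have hF : ∀ p, F (Ideal.Quotient.mk (Ideal.span {rel k}) p) = d p := fun p =>
    hd _ _ (Function.surjInv_eq Ideal.Quotient.mk_surjective _)
  refine ⟨Derivation.mk' ⟨⟨F, ?_⟩, ?_⟩ ?_, ?_⟩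
  · intro a b
    obtain ⟨a, rfl⟩ := Ideal.Quotient.mk_surjective a
    obtain ⟨b, rfl⟩ := Ideal.Quotient.mk_surjective b
    rw [← map_add, hF, hF, hF, map_add]
  · intro c a
    obtain ⟨a, rfl⟩ := Ideal.Quotient.mk_surjective a
    have : c • (Ideal.Quotient.mk (Ideal.span {rel k}) a) =
      Ideal.Quotient.mk (Ideal.span {rel k}) (c • a) := rfl
    simp only [this, hF, RingHom.id_apply]
    exact d.map_smul c a
  · intro a b
    obtain ⟨a, rfl⟩ := Ideal.Quotient.mk_surjective a
    obtain ⟨b, rfl⟩ := Ideal.Quotient.mk_surjective b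
    change F _ = _ • F _ + _ • F _
    rw [← map_mul, hF, hF, hF, Derivation.leibniz]
    rfl
  · intro i
    change F _ = _
    rw [hF]
    exact mkDerivation_X _ _ _

lemma span_D (k : Type*) [Field k] :
    (⊤ : Submodule (RQ k) (KaehlerDifferential k (RQ k))) ≤
    Submodule.span (RQ k) (Set.range fun i : Fin 3 => KaehlerDifferential.D k (RQ k)
      (Ideal.Quotient.mk (Ideal.span {rel k}) (X i))) := by
  rw [← KaehlerDifferential.span_range_derivation, Submodule.span_le]
  rintro _ ⟨a, rfl⟩
  obtain ⟨p, rfl⟩ := Ideal.Quotient.mk_surjective a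
  induction p using MvPolynomial.induction_on with
  | C c =>
    have : Ideal.Quotient.mk (Ideal.span {rel k}) (C c) = algebraMap k (RQ k) c := rfl
    rw [this, Derivation.map_algebraMap]
    exact zero_mem _
  | add p q hp hq => rw [map_add, map_add]; exact add_mem hp hq
  | mul_X p i hp =>
    rw [map_mul, Derivation.leibniz]
    exact add_mem (Submodule.smul_mem _ _ (Submodule.subset_span ⟨i, rfl⟩))
      (Submodule.smul_mem _ _ hp)

lemma exists_iso (k S : Type*) [Field k] [CommRing S] [Algebra k S] [Algebra (RQ k) S]
    [IsScalarTower k (RQ k) S] (t : S)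
    (h0 : algebraMap (RQ k) S (Ideal.Quotient.mk (Ideal.span {rel k}) (X 0)) = t)
    (h1 : algebraMap (RQ k) S (Ideal.Quotient.mk (Ideal.span {rel k}) (X 1)) = 0)
    (h2 : algebraMap (RQ k) S (Ideal.Quotient.mk (Ideal.span {rel k}) (X 2)) = 0) :
    ∃ e : (S ⊗[RQ k] KaehlerDifferential k (RQ k)) ≃ₗ[S] (S × (S ⧸ Ideal.span {t}) × S),
      e (1 ⊗ₜ KaehlerDifferential.D k (RQ k) (Ideal.Quotient.mk (Ideal.span {rel k}) (X 0)))
        = (1, 0, 0) ∧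
      e (1 ⊗ₜ KaehlerDifferential.D k (RQ k) (Ideal.Quotient.mk (Ideal.span {rel k}) (X 1)))
        = (0, 1, 0) ∧
      e (1 ⊗ₜ KaehlerDifferential.D k (RQ k) (Ideal.Quotient.mk (Ideal.span {rel k}) (X 2)))
        = (0, 0, 1) := by
  set x := Ideal.Quotient.mk (Ideal.span {rel k}) (X 0) with hx
  set y := Ideal.Quotient.mk (Ideal.span {rel k}) (X 1) with hy
  set z := Ideal.Quotient.mk (Ideal.span {rel k}) (X 2) with hz
  have ht : Ideal.Quotient.mk (Ideal.span {t}) t = 0 :=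
    Ideal.Quotient.eq_zero_iff_mem.mpr (Ideal.subset_span rfl)
  obtain ⟨D, hD⟩ := exists_der k (S × (S ⧸ Ideal.span {t}) × S)
    ![(1, 0, 0), (0, 1, 0), (0, 0, 1)] (by
      rw [← hx, ← hy, ← hz]
      rw [← algebraMap_smul S x, ← algebraMap_smul S y, ← algebraMap_smul S z, h0, h1, h2]
      have : t • (1 : S ⧸ Ideal.span {t}) = 0 := by
        rw [← ht]
        change Ideal.Quotient.mk (Ideal.span {t}) (t * 1) = _
        rw [mul_one]
      simp [this])
  have hD0 := hD 0
  have hD1 := hD 1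
  have hD2 := hD 2
  simp only [Matrix.cons_val, ← hx, ← hy, ← hz] at hD0 hD1 hD2
  let φ : (S ⊗[RQ k] KaehlerDifferential k (RQ k)) →ₗ[S] (S × (S ⧸ Ideal.span {t}) × S) :=
    D.liftKaehlerDifferential.liftBaseChange S
  have hφ : ∀ r, φ (1 ⊗ₜ KaehlerDifferential.D k (RQ k) r) = D r := by
    intro r
    simp [φ]
  have hrel : x * y + z ^ 2 = 0 := by
    rw [hx, hy, hz, ← map_pow, ← map_mul, ← map_add]
    exact Ideal.Quotient.eq_zero_iff_mem.mpr (Ideal.subset_span rfl)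
  have hty : t • ((1 : S) ⊗ₜ[RQ k] KaehlerDifferential.D k (RQ k) y) = 0 := by
    have h : (1 : S) ⊗ₜ[RQ k] KaehlerDifferential.D k (RQ k) (x * y + z ^ 2) = 0 := by
      rw [hrel, map_zero, tmul_zero]
    have hsm : ∀ (r : RQ k) (m : KaehlerDifferential k (RQ k)),
        (1 : S) ⊗ₜ[RQ k] (r • m) = (algebraMap (RQ k) S r) • ((1 : S) ⊗ₜ[RQ k] m) := by
      exact one_tmul_smul
    rw [map_add, Derivation.leibniz, pow_two, Derivation.leibniz, tmul_add, tmul_add, tmul_add,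
      hsm, hsm, hsm, h0, h1, h2, zero_smul, zero_smul, add_zero, add_zero, add_zero] at h
    exact h
  let ψ : (S × (S ⧸ Ideal.span {t}) × S) →ₗ[S] (S ⊗[RQ k] KaehlerDifferential k (RQ k)) :=
    (LinearMap.toSpanSingleton S _ (1 ⊗ₜ KaehlerDifferential.D k (RQ k) x)).coprod
      ((Submodule.liftQ (Ideal.span {t})
        (LinearMap.toSpanSingleton S _ (1 ⊗ₜ KaehlerDifferential.D k (RQ k) y)) (by
          rw [Ideal.span, Submodule.span_le]
          rintro _ rfl
          simpa using hty)).coprod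
        (LinearMap.toSpanSingleton S _ (1 ⊗ₜ KaehlerDifferential.D k (RQ k) z)))
  have hψ0 : ψ (1, 0, 0) = 1 ⊗ₜ KaehlerDifferential.D k (RQ k) x := by simp [ψ]
  have hψ1 : ψ (0, 1, 0) = 1 ⊗ₜ KaehlerDifferential.D k (RQ k) y := by
    simp only [ψ, LinearMap.coprod_apply, map_zero, zero_add, add_zero]
    have : (1 : S ⧸ Ideal.span {t}) = Submodule.Quotient.mk (1 : S) := rfl
    rw [this, Submodule.liftQ_apply]
    simp
  have hψ2 : ψ (0, 0, 1) = 1 ⊗ₜ KaehlerDifferential.D k (RQ k) z := by simp [ψ]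
  have c1 : φ ∘ₗ ψ = LinearMap.id := by
    apply LinearMap.ext
    rintro ⟨a, b, c⟩
    obtain ⟨b, rfl⟩ := Ideal.Quotient.mk_surjective b
    have hb : ((a, Ideal.Quotient.mk (Ideal.span {t}) b, c) : S × (S ⧸ Ideal.span {t}) × S) =
        a • (1, 0, 0) + b • (0, 1, 0) + c • (0, 0, 1) := by
      have : b • (1 : S ⧸ Ideal.span {t}) = Ideal.Quotient.mk (Ideal.span {t}) b := by
        change Ideal.Quotient.mk (Ideal.span {t}) (b * 1) = _
        rw [mul_one]
      simp [this]
    simp only [hb, map_add, map_smul, LinearMap.comp_apply, hψ0, hψ1, hψ2, hφ, hD0, hD1, hD2,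
      LinearMap.id_apply]
  have c2 : ψ ∘ₗ φ = LinearMap.id := by
    apply TensorProduct.AlgebraTensorModule.ext
    intro s w
    have key : ∀ w : KaehlerDifferential k (RQ k), (ψ ∘ₗ φ) (1 ⊗ₜ w) = 1 ⊗ₜ w := by
      intro w
      have hw := span_D k (Submodule.mem_top (x := w))
      induction hw using Submodule.span_induction with
      | mem w h =>
        obtain ⟨i, rfl⟩ := h
        simp only [LinearMap.comp_apply, hφ, hD]
        fin_cases i
        · exact hψ0
        · exact hψ1
        · exact hψ2
      | zero => simp
      | add a b _ _ ha hb => rw [tmul_add, map_add, ha, hb]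
      | smul r a _ ha => rw [one_tmul_smul, map_smul, ha]
    have : s ⊗ₜ[RQ k] w = s • ((1 : S) ⊗ₜ[RQ k] w) := by
      rw [smul_tmul', smul_eq_mul, mul_one]
    rw [this, map_smul, key, LinearMap.id_apply]
  exact ⟨LinearEquiv.ofLinearMap φ ψ c1 c2, (hφ x).trans hD0, (hφ y).trans hD1, (hφ z).trans hD2⟩

lemma modLength_of_surj {S M L : Type*} [CommRing S] [AddCommGroup M] [Module S M]
    [AddCommGroup L] [Module S L] (P : Submodule S M) (f : M →ₗ[S] L)
    (hf : Function.Surjective f) (hk : LinearMap.ker f = P) :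
    modLength S (M ⧸ P) = (Module.length S L : WithBot ℕ∞) := by
  subst hk
  rw [modLength, ← Module.coe_length, (f.quotKerEquivOfSurjective hf).length_eq]

lemma lengths (S M : Type*) [CommRing S] [IsDomain S] [AddCommGroup M] [Module S M] (t : S)
    (ht : (Ideal.span {t}).IsMaximal) (ht0 : t ≠ 0) (h2 : IsUnit (2 : S))
    (e : M ≃ₗ[S] (S × (S ⧸ Ideal.span {t}) × S)) (w : Fin 3 → M)
    (w0 : e (w 0) = (2 * t, 0, 0)) (w1 : e (w 1) = 0) (w2 : e (w 2) = (0, 0, t)) :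
    modLength S (M ⧸ Submodule.span S {m | ∃ i, m = w i}) = 3 ∧
    modLength S ((M ⧸ Submodule.torsion S M) ⧸ Submodule.span S {m | ∃ i, m =
      (Submodule.torsion S M).mkQ (w i)}) = 2 := by
  have hsimple : IsSimpleModule S (S ⧸ Ideal.span {t}) :=
    isSimpleModule_iff_isCoatom.mpr ht.out
  have hl : Module.length S (S ⧸ Ideal.span {t}) = 1 := Module.length_eq_one _ _
  obtain ⟨v, hv⟩ := h2.exists_right_inv
  let q : S →ₗ[S] (S ⧸ Ideal.span {t}) := (Ideal.span {t}).mkQ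
  have hq : Function.Surjective q := Submodule.mkQ_surjective _
  have hqt : ∀ a, q a = 0 ↔ ∃ c, a = t * c := by
    intro a
    exact (Submodule.Quotient.mk_eq_zero _).trans Ideal.mem_span_singleton
  have hqt0 : q t = 0 := (hqt t).mpr ⟨1, by simp⟩
  have hq2t : q (2 * t) = 0 := (hqt _).mpr ⟨2, by ring⟩
  constructor
  · let f : M →ₗ[S] (S ⧸ Ideal.span {t}) × (S ⧸ Ideal.span {t}) × (S ⧸ Ideal.span {t}) :=
      (q.prodMap (LinearMap.id.prodMap q)) ∘ₗ e.toLinearMap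
    have hf : ∀ m, f m = (q (e m).1, (e m).2.1, q (e m).2.2) := fun _ => rfl
    rw [modLength_of_surj _ f, Module.length_prod, Module.length_prod, hl]
    · norm_num
    · rintro ⟨a, b, c⟩
      obtain ⟨a, rfl⟩ := hq a
      obtain ⟨c, rfl⟩ := hq c
      exact ⟨e.symm (a, b, c), by rw [hf]; simp⟩
    · apply le_antisymm
      · intro m hm
        rw [LinearMap.mem_ker, hf] at hm
        simp only [Prod.mk_eq_zero] at hm
        obtain ⟨ha, hb, hc⟩ := hm
        obtain ⟨a, ha⟩ := (hqt _).mp ha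
        obtain ⟨c, hc⟩ := (hqt _).mp hc
        have : m = (v * a) • w 0 + c • w 2 := by
          apply e.injective
          rw [map_add, map_smul, map_smul, w0, w2]
          refine Prod.ext ?_ (Prod.ext ?_ ?_)
          · simp only [Prod.fst_add, Prod.smul_mk, smul_eq_mul, ha]
            linear_combination (-t * a) * hv
          · simp [hb]
          · simp [hc, mul_comm]
        rw [this]
        exact add_mem (Submodule.smul_mem _ _ (Submodule.subset_span ⟨0, rfl⟩))
          (Submodule.smul_mem _ _ (Submodule.subset_span ⟨2, rfl⟩))
      · rw [Submodule.span_le]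
        rintro _ ⟨i, rfl⟩
        rw [SetLike.mem_coe, LinearMap.mem_ker, hf]
        fin_cases i
        · simp [w0, hq2t]
        · simp [w1]
        · simp [w2, hqt0]
  · let f0 : M →ₗ[S] S × S :=
      ((LinearMap.id).prodMap (LinearMap.snd S _ S)) ∘ₗ e.toLinearMap
    have hf0 : ∀ m, f0 m = ((e m).1, (e m).2.2) := fun _ => rfl
    have htor : ∀ m ∈ Submodule.torsion S M, f0 m = 0 := by
      intro m hm
      obtain ⟨a, ha⟩ := (Submodule.mem_torsion_iff m).mp hm
      have ha' : (a : S) • f0 m = 0 := by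
        rw [← map_smul]
        have : (a : S) • m = 0 := ha
        rw [this, map_zero]
      exact (smul_eq_zero.mp ha').resolve_left (nonZeroDivisors.ne_zero a.2)
    let f : (M ⧸ Submodule.torsion S M) →ₗ[S] (S ⧸ Ideal.span {t}) × (S ⧸ Ideal.span {t}) :=
      (q.prodMap q) ∘ₗ (Submodule.torsion S M).liftQ f0 htor
    have hf : ∀ m, f ((Submodule.torsion S M).mkQ m) = (q (e m).1, q (e m).2.2) := fun _ => rfl
    rw [modLength_of_surj _ f, Module.length_prod, hl]
    · norm_num
    · rintro ⟨a, c⟩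
      obtain ⟨a, rfl⟩ := hq a
      obtain ⟨c, rfl⟩ := hq c
      exact ⟨(Submodule.torsion S M).mkQ (e.symm (a, 0, c)), by rw [hf]; simp⟩
    · apply le_antisymm
      · intro m hm
        obtain ⟨m, rfl⟩ := Submodule.mkQ_surjective _ m
        rw [LinearMap.mem_ker, hf] at hm
        simp only [Prod.mk_eq_zero] at hm
        obtain ⟨ha, hc⟩ := hm
        obtain ⟨a, ha⟩ := (hqt _).mp ha
        obtain ⟨c, hc⟩ := (hqt _).mp hc
        have : (Submodule.torsion S M).mkQ m =
            (Submodule.torsion S M).mkQ ((v * a) • w 0 + c • w 2) := by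
          rw [← sub_eq_zero, ← map_sub]
          refine (Submodule.Quotient.mk_eq_zero _).mpr ?_
          refine (Submodule.mem_torsion_iff _).mpr
            ⟨⟨t, mem_nonZeroDivisors_of_ne_zero ht0⟩, ?_⟩
          change t • _ = (0 : M)
          apply e.injective
          rw [map_smul, map_sub, map_add, map_smul, map_smul, w0, w2, map_zero]
          refine Prod.ext ?_ (Prod.ext ?_ ?_)
          · simp only [Prod.fst_add, Prod.fst_sub, Prod.smul_fst, smul_eq_mul, ha, Prod.fst_zero]
            linear_combination (-t * t * a) * hv
          · obtain ⟨b, hb⟩ := hq (e m).2.1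
            have : q (t * b) = 0 := (hqt _).mpr ⟨b, rfl⟩
            simp only [Prod.snd_add, Prod.fst_add, Prod.snd_sub, Prod.fst_sub, Prod.smul_fst,
              Prod.smul_snd, Prod.fst_zero, Prod.snd_zero, smul_zero, add_zero, sub_zero]
            rw [← hb, ← map_smul, smul_eq_mul, this]
          · simp [hc, mul_comm]
        rw [this, map_add, map_smul, map_smul]
        exact add_mem (Submodule.smul_mem _ _ (Submodule.subset_span ⟨0, rfl⟩))
          (Submodule.smul_mem _ _ (Submodule.subset_span ⟨2, rfl⟩))
      · rw [Submodule.span_le]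
        rintro _ ⟨i, rfl⟩
        rw [SetLike.mem_coe, LinearMap.mem_ker, hf]
        fin_cases i
        · simp [w0, hq2t]
        · simp [w1]
        · simp [w2, hqt0]

/-- Example `eg2`: for `R = k[x,y,z]/(xy+z²)`, `f : R → R` with `f(x)=x²`, `f(y)=xy`,
`f(z)=xz` and `γ : R → k[[t]]` with `γ(x)=t`, `γ(y)=γ(z)=0`, the pullback
`γ^*Ω_{R/k} = k[[t]] ⊗_R Ω_{R/k}` is isomorphic to `k[[t]]·dx ⊕ (k[[t]]/(t))·dy ⊕ k[[t]]·dz`;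
the cokernel of the map induced by `f` (whose image is spanned by `γ^*(d(f(x_i)))`) has
length `3`, while the cokernel of the induced map into `γ^*Ω_{R/k}` modulo its torsion has
length `2`. -/
theorem eg2_jacobian_orders (k : Type*) [Field k] [IsAlgClosed k] [CharZero k] :
    letI : Algebra (RQ k) (PowerSeries k) := (gam k).toRingHom.toAlgebra
    Nonempty ((PowerSeries k ⊗[RQ k] KaehlerDifferential k (RQ k)) ≃ₗ[PowerSeries k]
        (PowerSeries k ×
          (PowerSeries k ⧸ Ideal.span {(PowerSeries.X : PowerSeries k)}) × PowerSeries k)) ∧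
      modLength (PowerSeries k)
          ((PowerSeries k ⊗[RQ k] KaehlerDifferential k (RQ k)) ⧸
            Submodule.span (PowerSeries k)
              {w : PowerSeries k ⊗[RQ k] KaehlerDifferential k (RQ k) |
                ∃ i : Fin 3, w = (1 : PowerSeries k) ⊗ₜ[RQ k]
                  (KaehlerDifferential.D k (RQ k)
                    (fEnd k (Ideal.Quotient.mk (Ideal.span {rel k}) (X i))))}) =
        (3 : WithBot ℕ∞) ∧
      modLength (PowerSeries k)
          (((PowerSeries k ⊗[RQ k] KaehlerDifferential k (RQ k)) ⧸
              Submodule.torsion (PowerSeries k)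
                (PowerSeries k ⊗[RQ k] KaehlerDifferential k (RQ k))) ⧸
            Submodule.span (PowerSeries k)
              {w | ∃ i : Fin 3, w =
                (Submodule.torsion (PowerSeries k)
                  (PowerSeries k ⊗[RQ k] KaehlerDifferential k (RQ k))).mkQ
                  ((1 : PowerSeries k) ⊗ₜ[RQ k]
                    (KaehlerDifferential.D k (RQ k)
                      (fEnd k (Ideal.Quotient.mk (Ideal.span {rel k}) (X i)))))}) =
        (2 : WithBot ℕ∞) := by
  let _ : Algebra (RQ k) (PowerSeries k) := (gam k).toRingHom.toAlgebra
  have : IsScalarTower k (RQ k) (PowerSeries k) :=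
    IsScalarTower.of_algebraMap_eq fun c => ((gam k).commutes c).symm
  have ham : ∀ p, algebraMap (RQ k) (PowerSeries k) (Ideal.Quotient.mk (Ideal.span {rel k}) p) =
    aeval ![(PowerSeries.X : PowerSeries k), 0, 0] p := fun p => rfl
  have hfe : ∀ p, fEnd k (Ideal.Quotient.mk (Ideal.span {rel k}) p) =
    Ideal.Quotient.mk (Ideal.span {rel k}) (g0 k p) := fun p => rfl
  have h0 := ham (X 0)
  have h1 := ham (X 1)
  have h2 := ham (X 2)
  simp only [aeval_X, Matrix.cons_val] at h0 h1 h2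
  obtain ⟨e, e0, e1, e2⟩ := exists_iso k (PowerSeries k) PowerSeries.X h0 h1 h2
  have hX : (PowerSeries.X : PowerSeries k) • (1 : PowerSeries k ⧸ Ideal.span {(PowerSeries.X : PowerSeries k)})
      = 0 := by
    change Ideal.Quotient.mk (Ideal.span {(PowerSeries.X : PowerSeries k)})
      ((PowerSeries.X : PowerSeries k) * 1) = _
    rw [mul_one]
    exact Ideal.Quotient.eq_zero_iff_mem.mpr (Ideal.subset_span rfl)
  have hsm : ∀ (r : RQ k) (m : KaehlerDifferential k (RQ k)),
      (1 : PowerSeries k) ⊗ₜ[RQ k] (r • m) =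
        (algebraMap (RQ k) (PowerSeries k) r) • ((1 : PowerSeries k) ⊗ₜ[RQ k] m) := by
    exact one_tmul_smul
  refine ⟨⟨e⟩, lengths (PowerSeries k) _ PowerSeries.X ?_ PowerSeries.X_ne_zero ?_ e
    (fun i => (1 : PowerSeries k) ⊗ₜ[RQ k] (KaehlerDifferential.D k (RQ k)
      (fEnd k (Ideal.Quotient.mk (Ideal.span {rel k}) (X i))))) ?_ ?_ ?_⟩
  · rw [← PowerSeries.maximalIdeal_eq_span_X]
    infer_instance
  · have := (IsUnit.mk0 (2 : k) two_ne_zero).map (algebraMap k (PowerSeries k))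
    rwa [map_ofNat] at this
  · simp only [hfe, g0, aeval_X, Matrix.cons_val, pow_two, map_mul, Derivation.leibniz, tmul_add,
      hsm, h0, map_add, map_smul, e0]
    simp [two_mul]
  · simp only [hfe, g0, aeval_X, Matrix.cons_val, map_mul, Derivation.leibniz, tmul_add,
      hsm, h0, h1, map_add, map_smul, e0, e1]
    simp [hX]
  · simp only [hfe, g0, aeval_X, Matrix.cons_val, map_mul, Derivation.leibniz, tmul_add,
      hsm, h0, h2, map_add, map_smul, e0, e2]
    simp

end
end
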